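/- arXiv:math/9802126 — 5 statements merged into one kernel-verified Lean document; each statement's English description precedes it below -/
import Mathlib

section
/- Let V be a finite-dimensional real vector space with symmetric bilinear form ⟨·,·⟩ and 𝒞 the Clifford algebra of v ↦ −⟨v,v⟩. For any four vectors p₁, p₂, p₃, p₄ ∈ V, the element p₁p₂p₃p₄ + p₄p₃p₂p₁ of 𝒞 is a real scalar (i.e. lies in the image of ℝ under the structure map ℝ → 𝒞) if and only if p₁, p₂, p₃, p₄ are linearly dependent. In particular, four pairwise non-proportional isotropic vectors in Minkowski space ℝ^{n+2}_1 represent concircular points of the conformal n-sphere if and only if the Λ⁴-part r₄ of their cross ratio vanishes, i.e. iff their cross ratio is real. -/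
open CliffordAlgebra

/-- The quadratic form `v ↦ −⟨v,v⟩` associated to a bilinear form `B`. -/
noncomputable def Qneg {V : Type*} [AddCommGroup V] [Module ℝ V]
    (B : LinearMap.BilinForm ℝ V) : QuadraticForm ℝ V :=
  -(LinearMap.BilinMap.toQuadraticMap B)

namespace CliffordAlgebra

section CommRing

variable {R M : Type*} [CommRing R] [AddCommGroup M] [Module R M] (Q : QuadraticForm R M)

/-- The multilinear map sending four vectors to `p₁p₂p₃p₄ + p₄p₃p₂p₁`. -/
noncomputable def prodAddRevProd :
    MultilinearMap R (fun _ : Fin 4 => M) (CliffordAlgebra Q) :=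
  let f := (MultilinearMap.mkPiAlgebraFin R 4 (CliffordAlgebra Q)).compLinearMap fun _ => ι Q
  f + f.domDomCongr Fin.revPerm

theorem prodAddRevProd_apply (p : Fin 4 → M) :
    prodAddRevProd Q p = ι Q (p 0) * ι Q (p 1) * ι Q (p 2) * ι Q (p 3) +
      ι Q (p 3) * ι Q (p 2) * ι Q (p 1) * ι Q (p 0) := by
  have h0 : (0 : Fin 4).rev = 3 := rfl
  have h1 : (1 : Fin 4).rev = 2 := rfl
  have h2 : (2 : Fin 4).rev = 1 := rfl
  have h3 : (3 : Fin 4).rev = 0 := rfl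
  simp [prodAddRevProd, List.ofFn_succ, mul_assoc, Fin.succ, h0, h1, h2, h3]

variable {Q}

theorem ι_mul_ι_mul_ι_self_left (u v : M) :
    ι Q u * ι Q v * ι Q u = QuadraticMap.polar Q u v • ι Q u - Q u • ι Q v := by
  rw [ι_mul_ι_comm, sub_mul, mul_assoc, ι_sq_scalar, ← Algebra.smul_def, ← Algebra.commutes,
    ← Algebra.smul_def]

theorem prod_add_rev_prod_of_eq_zero_one (u v w : M) :
    ι Q u * ι Q u * ι Q v * ι Q w + ι Q w * ι Q v * ι Q u * ι Q u =
      algebraMap R _ (Q u * QuadraticMap.polar Q v w) := by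
  rw [mul_assoc _ (ι Q u) (ι Q u), ι_sq_scalar, ← Algebra.commutes, mul_assoc, ← mul_add,
    ι_mul_ι_add_swap, map_mul]

theorem prod_add_rev_prod_of_eq_zero_two (u v w : M) :
    ι Q u * ι Q v * ι Q u * ι Q w + ι Q w * ι Q u * ι Q v * ι Q u =
      algebraMap R _ (QuadraticMap.polar Q u v * QuadraticMap.polar Q u w -
        Q u * QuadraticMap.polar Q v w) := by
  rw [mul_assoc (ι Q w), mul_assoc (ι Q w), ι_mul_ι_mul_ι_self_left, map_sub, map_mul, map_mul,
    ← ι_mul_ι_add_swap u w, ← ι_mul_ι_add_swap v w, ← Algebra.smul_def, ← Algebra.smul_def,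
    sub_mul, mul_sub, smul_mul_assoc, smul_mul_assoc, mul_smul_comm, mul_smul_comm, smul_add,
    smul_add]
  abel

theorem prod_add_rev_prod_of_eq_zero_three (u v w : M) :
    ι Q u * ι Q v * ι Q w * ι Q u + ι Q u * ι Q w * ι Q v * ι Q u =
      algebraMap R _ (QuadraticMap.polar Q v w * Q u) := by
  rw [← add_mul, mul_assoc, mul_assoc, ← mul_add, ι_mul_ι_add_swap, ← Algebra.commutes,
    mul_assoc, ι_sq_scalar, map_mul]

theorem prod_add_rev_prod_of_eq_one_two (u v w : M) :
    ι Q v * ι Q u * ι Q u * ι Q w + ι Q w * ι Q u * ι Q u * ι Q v =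
      algebraMap R _ (Q u * QuadraticMap.polar Q v w) := by
  rw [mul_assoc (ι Q v), mul_assoc (ι Q w), ι_sq_scalar, ← Algebra.commutes, ← Algebra.commutes,
    mul_assoc, mul_assoc, ← mul_add, ι_mul_ι_add_swap, map_mul]

/-- If two of the four vectors agree, then `p₁p₂p₃p₄ + p₄p₃p₂p₁` is a scalar. -/
theorem prodAddRevProd_mem_one_of_lt {p : Fin 4 → M} {i j : Fin 4} (hij : i < j)
    (h : p i = p j) : prodAddRevProd Q p ∈ (1 : Submodule R (CliffordAlgebra Q)) := by
  rw [prodAddRevProd_apply, Submodule.mem_one]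
  fin_cases i <;> fin_cases j <;> simp at hij h <;> rw [h]
  · exact ⟨_, (prod_add_rev_prod_of_eq_zero_one _ _ _).symm⟩
  · exact ⟨_, (prod_add_rev_prod_of_eq_zero_two _ _ _).symm⟩
  · exact ⟨_, (prod_add_rev_prod_of_eq_zero_three _ _ _).symm⟩
  · exact ⟨_, (prod_add_rev_prod_of_eq_one_two _ _ _).symm⟩
  · rw [add_comm]
    exact ⟨_, (prod_add_rev_prod_of_eq_zero_two _ _ _).symm⟩
  · rw [add_comm]
    exact ⟨_, (prod_add_rev_prod_of_eq_zero_one _ _ _).symm⟩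

/-- Modulo scalars, `p₁p₂p₃p₄ + p₄p₃p₂p₁` is alternating. -/
noncomputable def prodAddRevProdModScalars :
    M [⋀^Fin 4]→ₗ[R] (CliffordAlgebra Q ⧸ (1 : Submodule R (CliffordAlgebra Q))) :=
  { (Submodule.mkQ 1).compMultilinearMap (prodAddRevProd Q) with
    map_eq_zero_of_eq' := fun p i j h hij => by
      refine (Submodule.Quotient.mk_eq_zero _).2 ?_
      rcases hij.lt_or_gt with hlt | hlt
      · exact prodAddRevProd_mem_one_of_lt hlt h
      · exact prodAddRevProd_mem_one_of_lt hlt h.symm }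

end CommRing

variable {K V : Type*} [Field K] [NeZero (2 : K)] [AddCommGroup V] [Module K V]
  {Q : QuadraticForm K V}

theorem prodAddRevProd_notMem_one_of_linearIndependent {p : Fin 4 → V}
    (hp : LinearIndependent K p) :
    prodAddRevProd Q p ∉ (1 : Submodule K (CliffordAlgebra Q)) := by
  have : Invertible (2 : K) := invertibleOfNonzero two_ne_zero
  have hdual (i : Fin 4) : ∃ d : Module.Dual K V, ∀ j, d (p j) = if i = j then 1 else 0 := by
    obtain ⟨g, hg⟩ := (Finsupp.linearCombination K p).exists_leftInverse_of_injective
      (LinearMap.ker_eq_bot.2 hp)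
    refine ⟨Finsupp.lapply i ∘ₗ g, fun j => ?_⟩
    have := DFunLike.congr_fun hg (Finsupp.single j 1)
    simp only [LinearMap.comp_apply, Finsupp.linearCombination_single, one_smul,
      LinearMap.id_apply] at this
    simp [this, Finsupp.single_apply, eq_comm]
  choose d hd using hdual
  rw [prodAddRevProd_apply, Submodule.mem_one]
  rintro ⟨r, hr⟩
  have h := congrArg (fun x => contractLeft (d 3) (contractLeft (d 2)
    (contractLeft (d 1) (contractLeft (d 0) x)))) hr
  simp [mul_assoc, contractLeft_ι_mul, hd] at h
  have h2 := ((isUnit_of_invertible (2 : K)).map (algebraMap K (CliffordAlgebra Q))).ne_zero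
  rw [map_ofNat, ← one_add_one_eq_two] at h2
  exact h2 h.symm

/-- The element `p₁p₂p₃p₄ + p₄p₃p₂p₁` is a scalar iff the four vectors are dependent. -/
theorem prodAddRevProd_mem_one_iff {p : Fin 4 → V} :
    prodAddRevProd Q p ∈ (1 : Submodule K (CliffordAlgebra Q)) ↔ ¬ LinearIndependent K p := by
  refine ⟨fun h hp => prodAddRevProd_notMem_one_of_linearIndependent hp h, fun hp => ?_⟩
  exact (Submodule.Quotient.mk_eq_zero _).1
    ((prodAddRevProdModScalars (Q := Q)).map_linearDependent p hp)

end CliffordAlgebra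

/-- Let `𝒞` be the Clifford algebra of `v ↦ −⟨v,v⟩` for a symmetric
bilinear form `⟨·,·⟩` on a real vector space `V`.  For any `p₁, p₂, p₃, p₄ ∈ V`, the
element `p₁p₂p₃p₄ + p₄p₃p₂p₁` is a real scalar iff `p₁, p₂, p₃, p₄` are linearly
dependent.  In particular, pairwise non-proportional isotropic vectors represent
concircular points of the conformal sphere (i.e. they are linearly dependent) iff the
`Λ⁴`-part of their cross ratio vanishes, i.e. iff their cross ratio is real. -/
theorem stmt2 (V : Type*) [AddCommGroup V] [Module ℝ V]
    (B : LinearMap.BilinForm ℝ V) (hsymm : ∀ u v, B u v = B v u) :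
    (∀ p₁ p₂ p₃ p₄ : V,
      ((∃ r : ℝ,
          ι (Qneg B) p₁ * ι (Qneg B) p₂ * ι (Qneg B) p₃ * ι (Qneg B) p₄ +
            ι (Qneg B) p₄ * ι (Qneg B) p₃ * ι (Qneg B) p₂ * ι (Qneg B) p₁ =
            algebraMap ℝ (CliffordAlgebra (Qneg B)) r) ↔
        ¬ LinearIndependent ℝ ![p₁, p₂, p₃, p₄])) ∧
    (∀ p : Fin 4 → V, (∀ i, B (p i) (p i) = 0) →
      (∀ i j, i ≠ j → ∀ c : ℝ, p j ≠ c • p i) →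
      (¬ LinearIndependent ℝ p ↔
        ∃ r : ℝ,
          ι (Qneg B) (p 0) * ι (Qneg B) (p 1) * ι (Qneg B) (p 2) * ι (Qneg B) (p 3) +
            ι (Qneg B) (p 3) * ι (Qneg B) (p 2) * ι (Qneg B) (p 1) * ι (Qneg B) (p 0) =
            algebraMap ℝ (CliffordAlgebra (Qneg B)) r)) := by
  have key (p : Fin 4 → V) := prodAddRevProd_mem_one_iff (Q := Qneg B) (p := p)
  simp only [prodAddRevProd_apply, Submodule.mem_one, eq_comm (a := algebraMap ℝ _ _)] at key
  exact ⟨fun p₁ p₂ p₃ p₄ => key ![p₁, p₂, p₃, p₄], fun p _ _ => (key p).symm⟩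
end

section
/- Let V be a real vector space with symmetric bilinear form ⟨·,·⟩ and 𝒞 the Clifford algebra of v ↦ −⟨v,v⟩. If p₁, p₂, p₃, p₄ ∈ V are linearly dependent, then in 𝒞 one has the scalar identity p₁p₂p₃p₄ + p₄p₃p₂p₁ = 2(⟨p₁,p₂⟩⟨p₃,p₄⟩ − ⟨p₁,p₃⟩⟨p₂,p₄⟩ + ⟨p₁,p₄⟩⟨p₂,p₃⟩)·1. In particular, for concircular isotropic vectors with ⟨p₁,p₄⟩⟨p₂,p₃⟩ ≠ 0 the cross ratio equals the real number (l₁₂l₃₄ + l₁₄l₂₃ − l₁₃l₂₄)/(2 l₁₄ l₂₃), where l_{ij} = ⟨p_i,p_j⟩. -/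
open CliffordAlgebra

section Defect

variable {V : Type*} [AddCommGroup V] [Module ℝ V] (B : LinearMap.BilinForm ℝ V)

/-- The Clifford relation for `v ↦ −⟨v,v⟩`. -/
theorem ι_Qneg_mul_add_swap (hsymm : ∀ u v, B u v = B v u) (u v : V) :
    ι (Qneg B) u * ι (Qneg B) v + ι (Qneg B) v * ι (Qneg B) u =
      algebraMap ℝ (CliffordAlgebra (Qneg B)) (-2 * B u v) := by
  rw [ι_mul_ι_add_swap]
  congr 1
  simp only [Qneg, QuadraticMap.polar, neg_apply,
    LinearMap.BilinMap.toQuadraticMap_apply, map_add, LinearMap.add_apply, hsymm v u]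
  ring

/-- The difference between `p₁p₂p₃p₄ + p₄p₃p₂p₁` and the scalar it equals when the four vectors
are linearly dependent. -/
noncomputable def cliffordDefect (a b c d : V) : CliffordAlgebra (Qneg B) :=
  ι (Qneg B) a * ι (Qneg B) b * ι (Qneg B) c * ι (Qneg B) d +
      ι (Qneg B) d * ι (Qneg B) c * ι (Qneg B) b * ι (Qneg B) a -
    algebraMap ℝ (CliffordAlgebra (Qneg B)) (2 * (B a b * B c d - B a c * B b d + B a d * B b c))

variable {B}

theorem cliffordDefect_reverse (hsymm : ∀ u v, B u v = B v u) (a b c d : V) :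
    cliffordDefect B d c b a = cliffordDefect B a b c d := by
  rw [cliffordDefect, cliffordDefect, add_comm, hsymm d c, hsymm b a, hsymm d b, hsymm c a,
    hsymm d a, hsymm c b, mul_comm (B c d), mul_comm (B b d)]

theorem cliffordDefect_swap_left (hsymm : ∀ u v, B u v = B v u) (a b c d : V) :
    cliffordDefect B b a c d = -cliffordDefect B a b c d := by
  have hab := ι_Qneg_mul_add_swap B hsymm a b
  have hcd := ι_Qneg_mul_add_swap B hsymm c d
  rw [eq_neg_iff_add_eq_zero]
  simp only [cliffordDefect]
  generalize ι (Qneg B) a = x at *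
  generalize ι (Qneg B) b = y at *
  generalize ι (Qneg B) c = z at *
  generalize ι (Qneg B) d = w at *
  calc
    _ = (x * y + y * x) * (z * w) + w * z * (x * y + y * x) -
        algebraMap ℝ _ (4 * B a b * B c d) := by
      rw [hsymm b a, show 4 * B a b * B c d =
        2 * (B a b * B c d - B b c * B a d + B b d * B a c) +
        2 * (B a b * B c d - B a c * B b d + B a d * B b c) by ring, map_add]
      noncomm_ring
    _ = algebraMap ℝ _ (-2 * B a b) * (z * w + w * z) - algebraMap ℝ _ (4 * B a b * B c d) := by
      rw [hab, ← Algebra.commutes, mul_add]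
    _ = 0 := by
      rw [hcd, ← map_mul, ← map_sub, ← map_zero (algebraMap ℝ (CliffordAlgebra (Qneg B)))]
      congr 1
      ring

theorem cliffordDefect_swap_middle (hsymm : ∀ u v, B u v = B v u) (a b c d : V) :
    cliffordDefect B a c b d = -cliffordDefect B a b c d := by
  have hbc := ι_Qneg_mul_add_swap B hsymm b c
  have had := ι_Qneg_mul_add_swap B hsymm a d
  rw [eq_neg_iff_add_eq_zero]
  simp only [cliffordDefect]
  generalize ι (Qneg B) a = x at *
  generalize ι (Qneg B) b = y at *
  generalize ι (Qneg B) c = z at *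
  generalize ι (Qneg B) d = w at *
  calc
    _ = x * (y * z + z * y) * w + w * (y * z + z * y) * x -
        algebraMap ℝ _ (4 * B b c * B a d) := by
      rw [hsymm c b, show 4 * B b c * B a d =
        2 * (B a c * B b d - B a b * B c d + B a d * B b c) +
        2 * (B a b * B c d - B a c * B b d + B a d * B b c) by ring, map_add]
      noncomm_ring
    _ = algebraMap ℝ _ (-2 * B b c) * (x * w + w * x) - algebraMap ℝ _ (4 * B b c * B a d) := by
      rw [hbc, ← Algebra.commutes _ x, ← Algebra.commutes _ w, mul_add, mul_assoc, mul_assoc]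
    _ = 0 := by
      rw [had, ← map_mul, ← map_sub, ← map_zero (algebraMap ℝ (CliffordAlgebra (Qneg B)))]
      congr 1
      ring

theorem cliffordDefect_swap_right (hsymm : ∀ u v, B u v = B v u) (a b c d : V) :
    cliffordDefect B a b d c = -cliffordDefect B a b c d := by
  rw [← cliffordDefect_reverse hsymm, cliffordDefect_swap_left hsymm,
    cliffordDefect_reverse hsymm]

theorem eq_zero_of_eq_neg_self {M : Type*} [AddCommGroup M] [Module ℝ M] {x : M} (h : x = -x) :
    x = 0 := by
  have : IsAddTorsionFree M := .of_isTorsionFree ℝ M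
  exact self_eq_neg.mp h

theorem cliffordDefect_self_left (hsymm : ∀ u v, B u v = B v u) (a c d : V) :
    cliffordDefect B a a c d = 0 :=
  eq_zero_of_eq_neg_self (cliffordDefect_swap_left hsymm a a c d)

theorem cliffordDefect_self_middle (hsymm : ∀ u v, B u v = B v u) (a b d : V) :
    cliffordDefect B a b b d = 0 :=
  eq_zero_of_eq_neg_self (cliffordDefect_swap_middle hsymm a b b d)

theorem cliffordDefect_add_first (a a' b c d : V) :
    cliffordDefect B (a + a') b c d = cliffordDefect B a b c d + cliffordDefect B a' b c d := by
  simp only [cliffordDefect, map_add, map_sub, map_mul, LinearMap.add_apply]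
  noncomm_ring

theorem cliffordDefect_add_second (a b b' c d : V) :
    cliffordDefect B a (b + b') c d = cliffordDefect B a b c d + cliffordDefect B a b' c d := by
  simp only [cliffordDefect, map_add, map_sub, map_mul, LinearMap.add_apply]
  noncomm_ring

theorem cliffordDefect_add_third (a b c c' d : V) :
    cliffordDefect B a b (c + c') d = cliffordDefect B a b c d + cliffordDefect B a b c' d := by
  simp only [cliffordDefect, map_add, map_sub, map_mul, LinearMap.add_apply]
  noncomm_ring

theorem cliffordDefect_add_fourth (a b c d d' : V) :
    cliffordDefect B a b c (d + d') = cliffordDefect B a b c d + cliffordDefect B a b c d' := by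
  simp only [cliffordDefect, map_add, map_sub, map_mul]
  noncomm_ring

theorem cliffordDefect_smul_first (r : ℝ) (a b c d : V) :
    cliffordDefect B (r • a) b c d = r • cliffordDefect B a b c d := by
  simp only [cliffordDefect, map_smul, LinearMap.smul_apply, smul_mul_assoc, mul_smul_comm,
    smul_sub, smul_add, Algebra.algebraMap_eq_smul_one, smul_smul, smul_eq_mul]
  congr 2
  ring

theorem cliffordDefect_smul_second (r : ℝ) (a b c d : V) :
    cliffordDefect B a (r • b) c d = r • cliffordDefect B a b c d := by
  simp only [cliffordDefect, map_smul, LinearMap.smul_apply, smul_mul_assoc, mul_smul_comm,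
    smul_sub, smul_add, Algebra.algebraMap_eq_smul_one, smul_smul, smul_eq_mul]
  congr 2
  ring

theorem cliffordDefect_smul_third (r : ℝ) (a b c d : V) :
    cliffordDefect B a b (r • c) d = r • cliffordDefect B a b c d := by
  simp only [cliffordDefect, map_smul, LinearMap.smul_apply, smul_mul_assoc, mul_smul_comm,
    smul_sub, smul_add, Algebra.algebraMap_eq_smul_one, smul_smul, smul_eq_mul]
  congr 2
  ring

theorem cliffordDefect_smul_fourth (r : ℝ) (a b c d : V) :
    cliffordDefect B a b c (r • d) = r • cliffordDefect B a b c d := by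
  simp only [cliffordDefect, map_smul, smul_mul_assoc, mul_smul_comm,
    smul_sub, smul_add, Algebra.algebraMap_eq_smul_one, smul_smul, smul_eq_mul]
  congr 2
  ring

/-- The defect as an alternating map. -/
noncomputable def cliffordDefectAlternating (hsymm : ∀ u v, B u v = B v u) :
    V [⋀^Fin 4]→ₗ[ℝ] CliffordAlgebra (Qneg B) where
  toFun v := cliffordDefect B (v 0) (v 1) (v 2) (v 3)
  map_update_add' {inst} v i x y := by
    obtain rfl : inst = instDecidableEqFin 4 := Subsingleton.elim _ _
    fin_cases i
    · simpa using cliffordDefect_add_first ..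
    · simpa using cliffordDefect_add_second ..
    · simpa using cliffordDefect_add_third ..
    · simpa using cliffordDefect_add_fourth ..
  map_update_smul' {inst} v i r x := by
    obtain rfl : inst = instDecidableEqFin 4 := Subsingleton.elim _ _
    fin_cases i
    · simpa using cliffordDefect_smul_first ..
    · simpa using cliffordDefect_smul_second ..
    · simpa using cliffordDefect_smul_third ..
    · simpa using cliffordDefect_smul_fourth ..
  map_eq_zero_of_eq' v i j h hij := by
    wlog hlt : i < j generalizing i j
    · exact this j i h.symm hij.symm (lt_of_le_of_ne (not_lt.mp hlt) hij.symm)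
    fin_cases i <;> fin_cases j <;> simp at hlt h
    · rw [h, cliffordDefect_self_left hsymm]
    · rw [h, cliffordDefect_swap_middle hsymm, cliffordDefect_self_left hsymm, neg_zero]
    · rw [h, cliffordDefect_swap_right hsymm, cliffordDefect_swap_middle hsymm,
        cliffordDefect_self_left hsymm, neg_zero, neg_zero]
    · rw [h, cliffordDefect_self_middle hsymm]
    · rw [h, cliffordDefect_swap_right hsymm, cliffordDefect_self_middle hsymm, neg_zero]
    · rw [h, ← cliffordDefect_reverse hsymm, cliffordDefect_self_left hsymm]

end Defect

/-- In the Clifford algebra of `v ↦ −⟨v,v⟩`, if `p₁, p₂, p₃, p₄` are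
linearly dependent then `p₁p₂p₃p₄ + p₄p₃p₂p₁ =
2(⟨p₁,p₂⟩⟨p₃,p₄⟩ − ⟨p₁,p₃⟩⟨p₂,p₄⟩ + ⟨p₁,p₄⟩⟨p₂,p₃⟩)·1`.  In particular, for concircular
isotropic vectors with `⟨p₁,p₄⟩⟨p₂,p₃⟩ ≠ 0`, the cross ratio equals the real number
`(l₁₂l₃₄ + l₁₄l₂₃ − l₁₃l₂₄)/(2 l₁₄ l₂₃)` where `l_{ij} = ⟨p_i,p_j⟩`. -/
theorem stmt3 (V : Type*) [AddCommGroup V] [Module ℝ V]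
    (B : LinearMap.BilinForm ℝ V) (hsymm : ∀ u v, B u v = B v u)
    (p₁ p₂ p₃ p₄ : V) (hdep : ¬ LinearIndependent ℝ ![p₁, p₂, p₃, p₄]) :
    (ι (Qneg B) p₁ * ι (Qneg B) p₂ * ι (Qneg B) p₃ * ι (Qneg B) p₄ +
        ι (Qneg B) p₄ * ι (Qneg B) p₃ * ι (Qneg B) p₂ * ι (Qneg B) p₁ =
      algebraMap ℝ (CliffordAlgebra (Qneg B))
        (2 * (B p₁ p₂ * B p₃ p₄ - B p₁ p₃ * B p₂ p₄ + B p₁ p₄ * B p₂ p₃))) ∧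
    ((∀ i : Fin 4, B (![p₁, p₂, p₃, p₄] i) (![p₁, p₂, p₃, p₄] i) = 0) →
      B p₁ p₄ * B p₂ p₃ ≠ 0 →
      ι (Qneg B) p₁ * ι (Qneg B) p₂ * ι (Qneg B) p₃ * ι (Qneg B) p₄ +
          ι (Qneg B) p₄ * ι (Qneg B) p₃ * ι (Qneg B) p₂ * ι (Qneg B) p₁ =
        ((B p₁ p₂ * B p₃ p₄ + B p₁ p₄ * B p₂ p₃ - B p₁ p₃ * B p₂ p₄) /
            (2 * B p₁ p₄ * B p₂ p₃)) •
          ((ι (Qneg B) p₁ * ι (Qneg B) p₄ + ι (Qneg B) p₄ * ι (Qneg B) p₁) *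
            (ι (Qneg B) p₂ * ι (Qneg B) p₃ + ι (Qneg B) p₃ * ι (Qneg B) p₂))) := by
  have key : cliffordDefect B p₁ p₂ p₃ p₄ = 0 :=
    (cliffordDefectAlternating hsymm).map_linearDependent ![p₁, p₂, p₃, p₄] hdep
  have hmain := sub_eq_zero.mp key
  refine ⟨hmain, fun _ hne => ?_⟩
  obtain ⟨h14, h23⟩ := mul_ne_zero_iff.mp hne
  rw [hmain, ι_Qneg_mul_add_swap B hsymm, ι_Qneg_mul_add_swap B hsymm, ← map_mul,
    Algebra.smul_def, ← map_mul]
  congr 1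
  field_simp
  ring
end

section
/- Let V be a finite-dimensional real vector space and let ω be an element of the second exterior power Λ²V (a 2-vector in the exterior algebra of V). Then ω is decomposable (pure), i.e. ω = v ∧ w for some v, w ∈ V, if and only if ω ∧ ω = 0 in the exterior algebra. -/
open ExteriorAlgebra

namespace ExteriorAlgebra

open CliffordAlgebra (contractLeft)

section CommRing

variable {R M : Type*} [CommRing R] [AddCommGroup M] [Module R M]

/-- Contraction by a covector, on the exterior algebra. -/
noncomputable def contract (d : Module.Dual R M) : ExteriorAlgebra R M →ₗ[R] ExteriorAlgebra R M :=
  contractLeft (Q := (0 : QuadraticForm R M)) d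

theorem contract_ι (d : Module.Dual R M) (a : M) :
    contract d (ι R a) = algebraMap R _ (d a) :=
  CliffordAlgebra.contractLeft_ι _ d a

theorem contract_ι_mul (d : Module.Dual R M) (a : M) (x : ExteriorAlgebra R M) :
    contract d (ι R a * x) = d a • x - ι R a * contract d x :=
  CliffordAlgebra.contractLeft_ι_mul d a x

theorem contract_ι_mul_ι (d : Module.Dual R M) (a b : M) :
    contract d (ι R a * ι R b) = ι R (d a • b - d b • a) := by
  rw [contract_ι_mul, contract_ι, ← Algebra.commutes, ← Algebra.smul_def, map_sub, map_smul,
    map_smul]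

theorem ι_mul_ι_comm (a b : M) : ι R a * ι R b = -(ι R b * ι R a) :=
  eq_neg_of_add_eq_zero_left (ι_add_mul_swap a b)

variable {ω : ExteriorAlgebra R M}

theorem exists_contract_eq_ι (hω : ω ∈ LinearMap.range (ι R : M →ₗ[R] ExteriorAlgebra R M) ^ 2)
    (d : Module.Dual R M) : ∃ u, contract d ω = ι R u := by
  rw [pow_two] at hω
  induction hω using Submodule.mul_induction_on' with
  | mem_mul_mem m hm n hn =>
    obtain ⟨a, rfl⟩ := hm
    obtain ⟨b, rfl⟩ := hn
    exact ⟨_, contract_ι_mul_ι d a b⟩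
  | add x _ y _ hx hy =>
    obtain ⟨u, hu⟩ := hx
    obtain ⟨v, hv⟩ := hy
    exact ⟨u + v, by rw [map_add, hu, hv, map_add]⟩

theorem contract_mul_of_mem_sq
    (hω : ω ∈ LinearMap.range (ι R : M →ₗ[R] ExteriorAlgebra R M) ^ 2)
    (d : Module.Dual R M) (x : ExteriorAlgebra R M) :
    contract d (ω * x) = contract d ω * x + ω * contract d x := by
  rw [pow_two] at hω
  induction hω using Submodule.mul_induction_on' with
  | mem_mul_mem m hm n hn =>
    obtain ⟨a, rfl⟩ := hm
    obtain ⟨b, rfl⟩ := hn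
    rw [mul_assoc, contract_ι_mul, contract_ι_mul, contract_ι_mul_ι]
    simp only [map_sub, map_smul, mul_sub, sub_mul, smul_mul_assoc, mul_smul_comm, mul_assoc]
    abel
  | add y _ z _ hy hz =>
    rw [add_mul, map_add, hy, hz, map_add]
    noncomm_ring

theorem mul_ι_of_mem_sq
    (hω : ω ∈ LinearMap.range (ι R : M →ₗ[R] ExteriorAlgebra R M) ^ 2) (u : M) :
    ω * ι R u = ι R u * ω := by
  rw [pow_two] at hω
  induction hω using Submodule.mul_induction_on' with
  | mem_mul_mem m hm n hn =>
    obtain ⟨a, rfl⟩ := hm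
    obtain ⟨b, rfl⟩ := hn
    rw [mul_assoc, ι_mul_ι_comm b u, mul_neg, ← mul_assoc, ι_mul_ι_comm a u, neg_mul, neg_neg,
      mul_assoc]
  | add y _ z _ hy hz => rw [add_mul, mul_add, hy, hz]

/-- Euler's identity in degree two. -/
theorem sum_ι_mul_contract {I : Type*} [Fintype I] (b : Module.Basis I R M)
    (hω : ω ∈ LinearMap.range (ι R : M →ₗ[R] ExteriorAlgebra R M) ^ 2) :
    ∑ i, ι R (b i) * contract (b.coord i) ω = (2 : R) • ω := by
  rw [pow_two] at hω
  induction hω using Submodule.mul_induction_on' with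
  | mem_mul_mem m hm n hn =>
    obtain ⟨v, rfl⟩ := hm
    obtain ⟨w, rfl⟩ := hn
    have key (x y : M) : ∑ i, ι R (b i) * ι R (b.coord i x • y) = ι R x * ι R y := by
      conv_rhs => rw [← b.sum_repr x]
      simp only [map_sum, map_smul, Finset.sum_mul, smul_mul_assoc, mul_smul_comm,
        Module.Basis.coord_apply]
    simp only [contract_ι_mul_ι, map_sub (ι R), mul_sub, Finset.sum_sub_distrib, key]
    rw [ι_mul_ι_comm w v, two_smul, sub_neg_eq_add]
  | add y _ z _ hy hz => simp only [map_add, mul_add, Finset.sum_add_distrib, hy, hz, smul_add]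

end CommRing

variable {K V : Type*} [Field K] [NeZero (2 : K)] [AddCommGroup V] [Module K V]
  {ω : ExteriorAlgebra K V}

theorem ι_mul_eq_zero_of_mul_self_eq_zero
    (hω : ω ∈ LinearMap.range (ι K : V →ₗ[K] ExteriorAlgebra K V) ^ 2) (h : ω * ω = 0)
    {d : Module.Dual K V} {u : V} (hu : contract d ω = ι K u) : ι K u * ω = 0 := by
  have h2 := contract_mul_of_mem_sq hω d ω
  rw [h, map_zero, hu, mul_ι_of_mem_sq hω, ← two_smul K] at h2
  exact (smul_eq_zero.mp h2.symm).resolve_left two_ne_zero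

theorem exists_eq_ι_mul_ι_of_mul_self_eq_zero [FiniteDimensional K V]
    (hω : ω ∈ LinearMap.range (ι K : V →ₗ[K] ExteriorAlgebra K V) ^ 2) (h : ω * ω = 0) :
    ∃ v w : V, ω = ι K v * ι K w := by
  by_cases hc : ∀ d : Module.Dual K V, contract d ω = 0
  · refine ⟨0, 0, ?_⟩
    have h2 := sum_ι_mul_contract (Module.finBasis K V) hω
    simp only [hc, mul_zero, Finset.sum_const_zero] at h2
    simpa using (smul_eq_zero.mp h2.symm).resolve_left two_ne_zero
  · push Not at hc
    obtain ⟨d, hd⟩ := hc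
    obtain ⟨u, hu⟩ := exists_contract_eq_ι hω d
    rw [hu, Ne, ι_eq_zero_iff, ← Module.forall_dual_apply_eq_zero_iff K] at hd
    push Not at hd
    obtain ⟨e, he⟩ := hd
    obtain ⟨w, hw⟩ := exists_contract_eq_ι hω e
    have h2 := contract_ι_mul e u ω
    rw [ι_mul_eq_zero_of_mul_self_eq_zero hω h hu, map_zero, hw, eq_comm, sub_eq_zero] at h2
    refine ⟨(e u)⁻¹ • u, w, ?_⟩
    rw [map_smul, smul_mul_assoc, ← h2, inv_smul_smul₀ he]

end ExteriorAlgebra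

/-- Let `V` be a finite-dimensional real vector space and `ω` a
2-vector in the exterior algebra of `V` (an element of `Λ²V`).  Then `ω` is
decomposable (pure), i.e. `ω = v ∧ w` for some `v, w ∈ V`, if and only if
`ω ∧ ω = 0` in the exterior algebra. -/
theorem stmt8 (V : Type*) [AddCommGroup V] [Module ℝ V] [FiniteDimensional ℝ V]
    (ω : ExteriorAlgebra ℝ V)
    (hω : ω ∈ (LinearMap.range (ι ℝ : V →ₗ[ℝ] ExteriorAlgebra ℝ V)) ^ 2) :
    (∃ v w : V, ω = ι ℝ v * ι ℝ w) ↔ ω * ω = 0 := by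
  refine ⟨?_, exists_eq_ι_mul_ι_of_mul_self_eq_zero hω⟩
  rintro ⟨v, w, rfl⟩
  rw [← mul_assoc, mul_ι_of_mem_sq hω, ← mul_assoc, ι_sq_zero, zero_mul, zero_mul]
end

section
/- Let V be a real vector space with symmetric bilinear form ⟨·,·⟩ and 𝒞 the Clifford algebra of v ↦ −⟨v,v⟩. Suppose a, b, c, d ∈ V satisfy a² = b² = c² = d² = −1 in 𝒞 and the Maurer–Cartan relation a·c + b·d = 0 in 𝒞. Then the four vectors a, b, c, d span a linear subspace of V of dimension at most 2. (Geometrically: the four element spheres attached to the edges of an elementary quadrilateral of a discrete Ribaucour pair intersect in a common (n−2)-sphere; interpreted as points of projective (n+1)-space they are collinear.) -/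
open CliffordAlgebra

/-- If `ac + bd = 0` in a Clifford algebra, then every linear functional contracts this relation
to a linear relation among the vectors. -/
theorem CliffordAlgebra.contract_mul_add_mul_eq_zero {K V : Type*} [Field K] [AddCommGroup V]
    [Module K V] [Invertible (2 : K)] {Q : QuadraticForm K V} {a b c d : V}
    (h : ι Q a * ι Q c + ι Q b * ι Q d = 0) (f : Module.Dual K V) :
    f a • c - f c • a + (f b • d - f d • b) = 0 := by
  rw [← Module.forall_dual_apply_eq_zero_iff K]
  intro g
  have key := congrArg (contractLeft g) (congrArg (contractLeft f) h)
  simp only [map_add, map_sub, map_zero, contractLeft_ι_mul, contractLeft_ι,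
    contractLeft_mul_algebraMap, Algebra.smul_def, contractLeft_algebraMap_mul] at key
  simp only [← map_mul, ← map_sub, ← map_add] at key
  rw [map_eq_zero_iff _ (algebraMap K (CliffordAlgebra Q)).injective] at key
  simp only [map_add, map_sub, map_smul, smul_eq_mul]
  linear_combination key

/-- If `a ∧ c + b ∧ d = 0`, expressed through linear functionals, and `a` is not a multiple of `c`,
then `c` lies in the span of `b` and `d`. -/
theorem mem_span_pair_of_contract_eq_zero {K V : Type*} [Field K] [AddCommGroup V] [Module K V]
    {a b c d : V}
    (h : ∀ f : Module.Dual K V, f a • c - f c • a + (f b • d - f d • b) = 0)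
    (hac : a ∉ Submodule.span K {c}) : c ∈ Submodule.span K {b, d} := by
  obtain ⟨f, hfa, hf⟩ := Submodule.exists_le_ker_of_notMem hac
  have hfc : f c = 0 := hf (Submodule.mem_span_singleton_self c)
  have hrel := h f
  rw [hfc, zero_smul, sub_zero] at hrel
  have hc : f a • c = f d • b + (-f b) • d := by
    rw [← sub_eq_zero, ← hrel]
    module
  rw [← Submodule.smul_mem_iff _ hfa, hc]
  exact Submodule.mem_span_pair.2 ⟨_, _, rfl⟩

/-- If `a ∧ c + b ∧ d = 0`, expressed through linear functionals, then all four vectors lie in the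
span of two vectors. -/
theorem exists_subset_span_pair_of_contract_eq_zero {K V : Type*} [Field K] [AddCommGroup V]
    [Module K V] {a b c d : V}
    (h : ∀ f : Module.Dual K V, f a • c - f c • a + (f b • d - f d • b) = 0) :
    ∃ x y : V, ({a, b, c, d} : Set V) ⊆ Submodule.span K {x, y} := by
  have lift {x z : V} {p : Submodule K V} (hz : z ∈ Submodule.span K {x}) (hx : x ∈ p) : z ∈ p :=
    (Submodule.span_singleton_le_iff_mem x p).2 hx hz
  have left (x y : V) : x ∈ Submodule.span K {x, y} := Submodule.subset_span (by simp)
  have right (x y : V) : y ∈ Submodule.span K {x, y} := Submodule.subset_span (by simp)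
  -- If `a` and `c` are both multiples of `x`, then `x` and one of `b`, `d` span everything.
  have of_parallel (x : V) (ha : a ∈ Submodule.span K {x}) (hc : c ∈ Submodule.span K {x}) :
      ∃ x y : V, ({a, b, c, d} : Set V) ⊆ Submodule.span K {x, y} := by
    by_cases hbd : b ∈ Submodule.span K {d}
    · refine ⟨x, d, ?_⟩
      simp [Set.insert_subset_iff, lift ha (left x d), lift hc (left x d),
        lift hbd (right x d), right x d]
    · have hd : d ∈ Submodule.span K {a, c} := by
        refine mem_span_pair_of_contract_eq_zero (fun f => ?_) hbd
        rw [add_comm]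
        exact h f
      have hdx : d ∈ Submodule.span K {x} :=
        Submodule.span_le.2 (Set.pair_subset ha hc) hd
      refine ⟨x, b, ?_⟩
      simp [Set.insert_subset_iff, lift ha (left x b), lift hc (left x b),
        lift hdx (left x b), right x b]
  by_cases hac : a ∈ Submodule.span K {c}
  · exact of_parallel c hac (Submodule.mem_span_singleton_self c)
  by_cases hca : c ∈ Submodule.span K {a}
  · exact of_parallel a (Submodule.mem_span_singleton_self a) hca
  have hc := mem_span_pair_of_contract_eq_zero h hac
  have ha : a ∈ Submodule.span K {d, b} := by
    refine mem_span_pair_of_contract_eq_zero (fun f => ?_) hca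
    rw [← neg_eq_zero, ← h f]
    abel
  rw [Set.pair_comm] at ha
  exact ⟨b, d, by simp [Set.insert_subset_iff, ha, hc, left b d, right b d]⟩

/-- In the Clifford algebra of `v ↦ −⟨v,v⟩`, if `a, b, c, d ∈ V`
satisfy `a² = b² = c² = d² = −1` and the Maurer–Cartan relation `a·c + b·d = 0`, then
`a, b, c, d` span a linear subspace of `V` of dimension at most `2`.  (Geometrically:
the four element spheres attached to the edges of an elementary quadrilateral of a
discrete Ribaucour pair intersect in a common `(n−2)`-sphere; interpreted as points of
projective `(n+1)`-space they are collinear.) -/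
theorem stmt16 (V : Type*) [AddCommGroup V] [Module ℝ V]
    (B : LinearMap.BilinForm ℝ V) (hsymm : ∀ u v, B u v = B v u)
    (a b c d : V)
    (ha : ι (Qneg B) a * ι (Qneg B) a = -1)
    (hb : ι (Qneg B) b * ι (Qneg B) b = -1)
    (hc : ι (Qneg B) c * ι (Qneg B) c = -1)
    (hd : ι (Qneg B) d * ι (Qneg B) d = -1)
    (hMC : ι (Qneg B) a * ι (Qneg B) c + ι (Qneg B) b * ι (Qneg B) d = 0) :
    Module.finrank ℝ ↥(Submodule.span ℝ ({a, b, c, d} : Set V)) ≤ 2 := by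
  obtain ⟨x, y, hxy⟩ := exists_subset_span_pair_of_contract_eq_zero
    (CliffordAlgebra.contract_mul_add_mul_eq_zero hMC)
  classical
  calc Module.finrank ℝ (Submodule.span ℝ ({a, b, c, d} : Set V))
      ≤ Module.finrank ℝ (Submodule.span ℝ (({x, y} : Finset V) : Set V)) :=
        Submodule.finrank_mono (Submodule.span_le.2 (by simpa using hxy))
    _ ≤ ({x, y} : Finset V).card := finrank_span_finset_le_card _
    _ ≤ 2 := Finset.card_le_two
end

section
/- (Cauchy problem for an elementary 3-cell; Miquel configuration.) Let E be a 3-dimensional Euclidean space and Σ ⊂ E a sphere of positive radius. Let x, x₁, x₂, x₃, x₁₂, x₁₃, x₂₃ be seven pairwise distinct points of Σ such that each of the quadruples {x, x₁, x₁₂, x₂}, {x, x₂, x₂₃, x₃}, {x, x₁, x₁₃, x₃} is concyclic. Assume each of the triples (x₁, x₁₂, x₁₃), (x₂, x₁₂, x₂₃), (x₃, x₁₃, x₂₃) is affinely independent, so that each determines a unique circle C₁, C₂, C₃ respectively, and assume C₁, C₂, C₃ are pairwise distinct. Then there is a point y ∈ Σ lying on all three circles C₁, C₂, C₃ — i.e.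 such that the quadruples {x₁, x₁₂, y, x₁₃}, {x₂, x₁₂, y, x₂₃}, {x₃, x₁₃, y, x₂₃} are each concyclic — and any point lying on all three circles equals y or belongs to {x₁₂, x₁₃, x₂₃}. Thus the missing eighth vertex of an elementary 3-cell of a discrete curvature line net is determined by the other seven. -/
open EuclideanGeometry Metric

section Miquel

open Module RealInnerProductSpace

/-- A set whose difference vectors from a base point lie in a subspace of dimension at most two
is coplanar. -/
theorem coplanar_of_vsub_mem {V P : Type*} [AddCommGroup V] [Module ℝ V] [AddTorsor V P]
    [FiniteDimensional ℝ V] {s : Set P} (x : P) (W : Submodule ℝ V) (hW : finrank ℝ W ≤ 2)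
    (h : ∀ p ∈ s, p -ᵥ x ∈ W) : Coplanar ℝ s := by
  rw [coplanar_iff_finrank_le_two]
  refine (Submodule.finrank_mono ?_).trans hW
  rw [vectorSpan_def, Submodule.span_le]
  rintro _ ⟨p, hp, q, hq, rfl⟩
  simpa using W.sub_mem (h p hp) (h q hq)

/-- Three affinely independent points of a coplanar set span the same plane as the set. -/
theorem Coplanar.affineSpan_triple_eq {V P : Type*} [AddCommGroup V] [Module ℝ V] [AddTorsor V P]
    [FiniteDimensional ℝ V] {s : Set P} (hs : Coplanar ℝ s) {a b c : P}
    (hi : AffineIndependent ℝ ![a, b, c]) (ha : a ∈ s) (hb : b ∈ s) (hc : c ∈ s) :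
    affineSpan ℝ {a, b, c} = affineSpan ℝ s := by
  have hsub : ({a, b, c} : Set P) ⊆ s := by
    rintro p (rfl | rfl | rfl) <;> assumption
  have hr : Set.range ![a, b, c] = {a, b, c} := by
    ext p; simp [eq_comm]; tauto
  have h2 : finrank ℝ (vectorSpan ℝ ({a, b, c} : Set P)) = 2 := by
    rw [← hr]; exact hi.finrank_vectorSpan (by simp)
  have hdir : vectorSpan ℝ ({a, b, c} : Set P) = vectorSpan ℝ s :=
    Submodule.eq_of_le_of_finrank_le (vectorSpan_mono ℝ hsub) (h2 ▸ hs.finrank_le_two)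
  refine AffineSubspace.ext_of_direction_eq ?_ ⟨a, ?_, ?_⟩
  · rw [direction_affineSpan, direction_affineSpan, hdir]
  · exact mem_affineSpan ℝ (by simp)
  · exact mem_affineSpan ℝ ha

/-- Points of the plane through three points have coordinates relative to the first one. -/
theorem exists_sub_eq_of_mem_affineSpan_triple {V : Type*} [AddCommGroup V] [Module ℝ V]
    {a b c p : V} (hp : p ∈ affineSpan ℝ ({a, b, c} : Set V)) :
    ∃ s t : ℝ, p - a = s • (b - a) + t • (c - a) := by
  have hmem : p - a ∈ vectorSpan ℝ ({a, b, c} : Set V) := by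
    rw [← direction_affineSpan]
    exact AffineSubspace.vsub_mem_direction hp (mem_affineSpan ℝ (by simp))
  have hle : vectorSpan ℝ ({a, b, c} : Set V) ≤ Submodule.span ℝ {b - a, c - a} := by
    rw [vectorSpan_eq_span_vsub_set_right ℝ (Set.mem_insert a {b, c}), Submodule.span_le]
    rintro _ ⟨q, (rfl | rfl | rfl), rfl⟩
    · simp
    · exact Submodule.subset_span (by simp)
    · exact Submodule.subset_span (by simp)
  obtain ⟨s, t, h⟩ := Submodule.mem_span_pair.1 (hle hmem)
  exact ⟨s, t, h.symm⟩

/-- A subset of the plane through three points is coplanar. -/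
theorem coplanar_of_subset_affineSpan_triple {V P : Type*} [AddCommGroup V] [Module ℝ V]
    [AddTorsor V P] [FiniteDimensional ℝ V] {s : Set P} {a b c : P}
    (h : s ⊆ affineSpan ℝ ({a, b, c} : Set P)) : Coplanar ℝ s := by
  have hW : finrank ℝ (vectorSpan ℝ ({a, b, c} : Set P)) ≤ 2 :=
    (coplanar_triple ℝ a b c).finrank_le_two
  refine coplanar_of_vsub_mem a _ hW fun p hp ↦ ?_
  rw [← direction_affineSpan]
  exact AffineSubspace.vsub_mem_direction (h hp) (mem_affineSpan ℝ (by simp))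

variable {V : Type*} [NormedAddCommGroup V] [InnerProductSpace ℝ V]

/-- A circle meeting a sphere in three affinely independent points lies on that sphere. -/
theorem EuclideanGeometry.Concyclic.subset_sphere [FiniteDimensional ℝ V] {S : Set V}
    (hS : Concyclic S) {o : V} {R : ℝ} {a b c : V} (hi : AffineIndependent ℝ ![a, b, c])
    (ha : a ∈ S) (hb : b ∈ S) (hc : c ∈ S) (hao : a ∈ sphere o R) (hbo : b ∈ sphere o R)
    (hco : c ∈ sphere o R) : S ⊆ sphere o R := by
  intro z hz
  have hspan := hS.Coplanar.affineSpan_triple_eq hi ha hb hc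
  obtain ⟨s, t, hst⟩ := exists_sub_eq_of_mem_affineSpan_triple
    (hspan ▸ mem_affineSpan ℝ hz : z ∈ affineSpan ℝ ({a, b, c} : Set V))
  obtain ⟨o', R', hr⟩ := hS.Cospherical
  have key : ∀ p ∈ S, ⟪p - a, o' - o⟫ * 2 = (dist p o ^ 2 - dist a o ^ 2) := by
    intro p hp
    have h := congrArg (· ^ 2) ((hr p hp).trans (hr a ha).symm)
    simp only [dist_eq_norm, ← real_inner_self_eq_norm_sq, inner_sub_left, inner_sub_right,
      real_inner_comm] at h ⊢
    linarith [real_inner_comm o p, real_inner_comm o a, real_inner_comm o' p,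
      real_inner_comm o' a]
  have hkb := key b hb
  have hkc := key c hc
  have hkz := key z hz
  rw [Metric.mem_sphere] at hao hbo hco ⊢
  rw [hbo, hao, sub_self] at hkb
  rw [hco, hao, sub_self] at hkc
  rw [hst, inner_add_left, real_inner_smul_left, real_inner_smul_left, hao] at hkz
  have hR : 0 ≤ R := hao ▸ dist_nonneg
  refine (sq_eq_sq₀ dist_nonneg hR).1 ?_
  linear_combination s * hkb + t * hkc - hkz

/-- On a sphere through the origin, a point of the plane spanned by `a` and `b` that is neither
the origin nor `a` has nonzero `b`-coordinate. -/
theorem coeff_ne_zero_of_mem_sphere {o a b d : V} {p q : ℝ} (ha : ⟪a, a⟫ = 2 * ⟪o, a⟫)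
    (hd : ⟪d, d⟫ = 2 * ⟪o, d⟫) (hpq : d = p • a + q • b) (ha0 : a ≠ 0) (hd0 : d ≠ 0)
    (hda : d ≠ a) : q ≠ 0 := by
  rintro rfl
  rw [zero_smul, add_zero] at hpq
  subst hpq
  simp only [real_inner_smul_left, real_inner_smul_right] at hd
  have h : p * (p - 1) * ⟪a, a⟫ = 0 := by linear_combination hd - p * ha
  rcases mul_eq_zero.1 h with h | h
  · rcases mul_eq_zero.1 h with h | h
    · exact hd0 (by simp [h])
    · exact hda (by simp [sub_eq_zero.1 h])
  · exact ha0 (inner_self_eq_zero.1 h)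

/-- **Miquel's theorem on a sphere through the origin**, in terms of linear forms: the planes
`f i = r i` are those through the corresponding triples of points. -/
theorem exists_miquel_point [FiniteDimensional ℝ V] (e : Basis (Fin 3) ℝ V) {o d₁₂ d₁₃ d₂₃ : V}
    {p₁₂ q₁₂ p₁₃ q₁₃ p₂₃ q₂₃ : ℝ} (he : ∀ i, ⟪e i, e i⟫ = 2 * ⟪o, e i⟫)
    (h₁₂ : ⟪d₁₂, d₁₂⟫ = 2 * ⟪o, d₁₂⟫) (h₁₃ : ⟪d₁₃, d₁₃⟫ = 2 * ⟪o, d₁₃⟫)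
    (h₂₃ : ⟪d₂₃, d₂₃⟫ = 2 * ⟪o, d₂₃⟫)
    (hd₁₂ : d₁₂ = p₁₂ • e 0 + q₁₂ • e 1) (hd₁₃ : d₁₃ = p₁₃ • e 0 + q₁₃ • e 2)
    (hd₂₃ : d₂₃ = p₂₃ • e 1 + q₂₃ • e 2)
    (hp₁₂ : p₁₂ ≠ 0) (hq₁₂ : q₁₂ ≠ 0) (hp₁₃ : p₁₃ ≠ 0) (hq₁₃ : q₁₃ ≠ 0) (hp₂₃ : p₂₃ ≠ 0)
    (hq₂₃ : q₂₃ ≠ 0) :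
    ∃ (y : V) (f : Fin 3 → V →ₗ[ℝ] ℝ) (r : Fin 3 → ℝ), ⟪y, y⟫ = 2 * ⟪o, y⟫ ∧
      (∀ i, r i ≠ 0 ∧ f i (e i) = r i ∧ f i y = r i) ∧
      f 0 d₁₂ = r 0 ∧ f 0 d₁₃ = r 0 ∧ f 1 d₁₂ = r 1 ∧ f 1 d₂₃ = r 1 ∧
      f 2 d₁₃ = r 2 ∧ f 2 d₂₃ = r 2 := by
  have hn : ∀ i, ⟪e i, e i⟫ ≠ 0 := fun i h ↦ e.ne_zero i (inner_self_eq_zero.1 h)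
  let n : Fin 3 → ℝ := fun i ↦ ⟪e i, e i⟫
  let u := e.coord
  let f₁ : V →ₗ[ℝ] ℝ := n 0 • u 0 + (n 0 * (1 - p₁₂) / q₁₂) • u 1 + (n 0 * (1 - p₁₃) / q₁₃) • u 2
  let f₂ : V →ₗ[ℝ] ℝ := (n 1 * (1 - q₁₂) / p₁₂) • u 0 + n 1 • u 1 + (n 1 * (1 - p₂₃) / q₂₃) • u 2
  let f₃ : V →ₗ[ℝ] ℝ := (n 2 * (1 - q₁₃) / p₁₃) • u 0 + (n 2 * (1 - q₂₃) / p₂₃) • u 1 + n 2 • u 2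
  have hu : ∀ i j, u i (e j) = if j = i then 1 else 0 := by
    intro i j; simp [u, Finsupp.single_apply]
  have hf₁ : ∀ v, f₁ v = n 0 * u 0 v + (n 0 * (1 - p₁₂) / q₁₂) * u 1 v +
      (n 0 * (1 - p₁₃) / q₁₃) * u 2 v := fun v ↦ by simp [f₁]
  have hf₂ : ∀ v, f₂ v = (n 1 * (1 - q₁₂) / p₁₂) * u 0 v + n 1 * u 1 v +
      (n 1 * (1 - p₂₃) / q₂₃) * u 2 v := fun v ↦ by simp [f₂]
  have hf₃ : ∀ v, f₃ v = (n 2 * (1 - q₁₃) / p₁₃) * u 0 v + (n 2 * (1 - q₂₃) / p₂₃) * u 1 v +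
      n 2 * u 2 v := fun v ↦ by simp [f₃]
  have h1 : f₁ d₁₂ = n 0 := by simp [hf₁, hd₁₂, hu]; field_simp; ring
  have h2 : f₁ d₁₃ = n 0 := by simp [hf₁, hd₁₃, hu]; field_simp; ring
  have h3 : f₂ d₁₂ = n 1 := by simp [hf₂, hd₁₂, hu]; field_simp; ring
  have h4 : f₂ d₂₃ = n 1 := by simp [hf₂, hd₂₃, hu]; field_simp; ring
  have h5 : f₃ d₁₃ = n 2 := by simp [hf₃, hd₁₃, hu]; field_simp; ring
  have h6 : f₃ d₂₃ = n 2 := by simp [hf₃, hd₂₃, hu]; field_simp; ring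
  -- The mixed coefficients of the three forms add up to those of the quadratic form.
  have hmix : ∀ {i j : Fin 3} {d : V} {p q : ℝ}, ⟪d, d⟫ = 2 * ⟪o, d⟫ → d = p • e i + q • e j →
      p ≠ 0 → q ≠ 0 → n i * (1 - p) / q + n j * (1 - q) / p = 2 * ⟪e i, e j⟫ := by
    intro i j d p q hd hpq hp hq
    rw [hpq] at hd
    simp only [inner_add_left, inner_add_right, real_inner_smul_left, real_inner_smul_right] at hd
    rw [real_inner_comm (e i) (e j)] at hd
    have hi := he i
    have hj := he j
    simp only [n]
    field_simp
    linear_combination -hd + p * hi + q * hj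
  have m₁₂ := hmix h₁₂ hd₁₂ hp₁₂ hq₁₂
  have m₁₃ := hmix h₁₃ hd₁₃ hp₁₃ hq₁₃
  have m₂₃ := hmix h₂₃ hd₂₃ hp₂₃ hq₂₃
  have key : ∀ v, ⟪v, v⟫ - 2 * ⟪o, v⟫ =
      u 0 v * (f₁ v - n 0) + u 1 v * (f₂ v - n 1) + u 2 v * (f₃ v - n 2) := by
    intro v
    have hv : v = u 0 v • e 0 + u 1 v • e 1 + u 2 v • e 2 := by
      conv_lhs => rw [← e.sum_repr v, Fin.sum_univ_three]
      rfl
    have hin : ⟪v, v⟫ - 2 * ⟪o, v⟫ = u 0 v * u 0 v * n 0 + u 1 v * u 1 v * n 1 +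
        u 2 v * u 2 v * n 2 + 2 * u 0 v * u 1 v * ⟪e 0, e 1⟫ + 2 * u 0 v * u 2 v * ⟪e 0, e 2⟫ +
        2 * u 1 v * u 2 v * ⟪e 1, e 2⟫ - u 0 v * n 0 - u 1 v * n 1 - u 2 v * n 2 := by
      generalize u 0 v = a, u 1 v = b, u 2 v = c at hv
      subst hv
      simp only [inner_add_left, inner_add_right, real_inner_smul_left, real_inner_smul_right, n]
      rw [real_inner_comm (e 0) (e 1), real_inner_comm (e 0) (e 2), real_inner_comm (e 1) (e 2)]
      linear_combination a * he 0 + b * he 1 + c * he 2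
    rw [hin, hf₁, hf₂, hf₃]
    linear_combination -(u 0 v * u 1 v) * m₁₂ - (u 0 v * u 2 v) * m₁₃ - (u 1 v * u 2 v) * m₂₃
  obtain ⟨v, hv0, hv₁, hv₂⟩ : ∃ v : V, v ≠ 0 ∧ f₁ v = 0 ∧ f₂ v = 0 := by
    have hker : LinearMap.ker (f₁.prod f₂) ≠ ⊥ := LinearMap.ker_ne_bot_of_finrank_lt (by
      rw [finrank_eq_card_basis e]; simp)
    obtain ⟨v, hv, hv0⟩ := Submodule.exists_mem_ne_zero_of_ne_bot hker
    have hv' : f₁ v = 0 ∧ f₂ v = 0 := by simpa using hv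
    exact ⟨v, hv0, hv'⟩
  have hvv : ⟪v, v⟫ ≠ 0 := fun h ↦ hv0 (inner_self_eq_zero.1 h)
  have hu₂ : u 2 d₁₂ = 0 := by simp [hd₁₂, hu]
  have hline : ∀ t : ℝ, t * (2 * (⟪d₁₂, v⟫ - ⟪o, v⟫) + t * ⟪v, v⟫) =
      t * u 2 v * (f₃ d₁₂ - n 2 + t * f₃ v) := by
    intro t
    have h := key (d₁₂ + t • v)
    simp only [map_add, map_smul, h1, h3, hv₁, hv₂, hu₂, inner_add_left, inner_add_right,
      real_inner_smul_left, real_inner_smul_right, smul_eq_mul] at h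
    rw [real_inner_comm d₁₂ v] at h
    linear_combination h - h₁₂
  have hu₂v : u 2 v ≠ 0 := by
    intro h0
    have ha := hline 1
    have hb := hline (-1)
    rw [h0] at ha hb
    exact hvv (by linarith)
  set t₀ := -(2 * (⟪d₁₂, v⟫ - ⟪o, v⟫)) / ⟪v, v⟫ with ht₀
  have ht₀' : 2 * (⟪d₁₂, v⟫ - ⟪o, v⟫) + t₀ * ⟪v, v⟫ = 0 := by
    rw [ht₀]; field_simp; ring
  have hf₃y : f₃ d₁₂ - n 2 + t₀ * f₃ v = 0 := by
    have ha := hline 1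
    have hb := hline (-1)
    have hc : u 2 v * (f₃ d₁₂ - n 2 + t₀ * f₃ v) = 0 := by
      linear_combination (-1 / 2 - t₀ / 2) * ha + (1 / 2 - t₀ / 2) * hb + ht₀'
    exact (mul_eq_zero.1 hc).resolve_left hu₂v
  refine ⟨d₁₂ + t₀ • v, ![f₁, f₂, f₃], n, ?_, ?_, h1, h2, h3, h4, h5, h6⟩
  · simp only [inner_add_left, inner_add_right, real_inner_smul_left, real_inner_smul_right]
    rw [real_inner_comm d₁₂ v]
    linear_combination h₁₂ + t₀ * ht₀'
  · intro i
    refine ⟨hn i, ?_, ?_⟩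
    · fin_cases i
      · simp [hf₁, hu]
      · simp [hf₂, hu]
      · simp [hf₃, hu]
    · fin_cases i
      · simp [h1, hv₁]
      · simp [h3, hv₂]
      · simpa [sub_add_eq_add_sub, sub_eq_zero] using hf₃y

/-- The equation of a sphere relative to one of its points. -/
theorem mem_sphere_iff_inner_sub {o x p : V} {R : ℝ} (hx : x ∈ sphere o R) :
    p ∈ sphere o R ↔ ⟪p - x, p - x⟫ = 2 * ⟪o - x, p - x⟫ := by
  have hR : 0 ≤ R := Metric.mem_sphere.1 hx ▸ dist_nonneg
  have h : dist p o ^ 2 - dist x o ^ 2 = ⟪p - x, p - x⟫ - 2 * ⟪o - x, p - x⟫ := by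
    simp only [dist_eq_norm, ← real_inner_self_eq_norm_sq, inner_sub_left, inner_sub_right]
    linarith [real_inner_comm o p, real_inner_comm o x, real_inner_comm x p]
  rw [Metric.mem_sphere] at hx ⊢
  rw [← sq_eq_sq₀ dist_nonneg hR, ← sub_eq_zero, ← sub_eq_zero (a := ⟪p - x, p - x⟫), ← h, hx]

theorem cospherical_of_subset_sphere {P : Type*} [MetricSpace P] {s : Set P} {o : P} {R : ℝ}
    (h : s ⊆ sphere o R) : Cospherical s :=
  ⟨o, R, fun _ hp ↦ h hp⟩

/-- Points of a sphere on which a nonzero linear form is constant are concyclic. -/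
theorem concyclic_of_linear_form_eq (hV : finrank ℝ V = 3) {s : Set V} {o : V} {R : ℝ}
    (hs : s ⊆ sphere o R) {f : V →ₗ[ℝ] ℝ} (hf : f ≠ 0) {x : V} {r : ℝ}
    (h : ∀ p ∈ s, f (p - x) = r) : Concyclic s := by
  have : FiniteDimensional ℝ V := .of_finrank_pos (by lia)
  refine ⟨cospherical_of_subset_sphere hs, ?_⟩
  rcases s.eq_empty_or_nonempty with rfl | ⟨p₀, hp₀⟩
  · exact coplanar_empty ℝ V
  refine coplanar_of_vsub_mem p₀ (LinearMap.ker f) ?_ fun p hp ↦ ?_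
  · have := f.finrank_range_add_finrank_ker
    rw [LinearMap.range_eq_top.2 (LinearMap.surjective hf), finrank_top, finrank_self] at this
    lia
  · have := (h p hp).trans (h p₀ hp₀).symm
    simp only [map_sub] at this
    simpa [sub_eq_zero] using this

/-- Two circles on a sphere, given by affinely independent triples `a, b, c` and `a', b, c'`, that
share three distinct points coincide. -/
theorem concyclic_of_three_common_points [FiniteDimensional ℝ V] {o : V} {R : ℝ}
    {a b c a' c' y z : V} (ha : a ∈ sphere o R) (hb : b ∈ sphere o R) (hc : c ∈ sphere o R)
    (ha' : a' ∈ sphere o R) (hc' : c' ∈ sphere o R) (hy : y ∈ sphere o R)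
    (hi : AffineIndependent ℝ ![a, b, c]) (hi' : AffineIndependent ℝ ![a', b, c'])
    (h₁y : Concyclic {a, b, y, c}) (h₁z : Concyclic {a, b, z, c})
    (h₂y : Concyclic {a', b, y, c'}) (h₂z : Concyclic {a', b, z, c'})
    (hby : b ≠ y) (hbz : b ≠ z) (hyz : y ≠ z) : Concyclic {a, b, c, a', c'} := by
  have hz : z ∈ sphere o R :=
    h₁z.subset_sphere hi (by simp) (by simp) (by simp) ha hb hc (by simp)
  have hib : AffineIndependent ℝ ![b, y, z] :=
    (cospherical_of_subset_sphere (o := o) (R := R)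
      (by rintro p (rfl | rfl | rfl) <;> assumption)).affineIndependent_of_ne hby hbz hyz
  have hplane : ∀ {a c : V}, AffineIndependent ℝ ![a, b, c] → Concyclic {a, b, y, c} →
      Concyclic {a, b, z, c} → affineSpan ℝ {a, b, c} = affineSpan ℝ {b, y, z} := by
    intro a c hi hy hz
    have ey := hy.Coplanar.affineSpan_triple_eq hi (by simp) (by simp) (by simp)
    have ez := hz.Coplanar.affineSpan_triple_eq hi (by simp) (by simp) (by simp)
    have hcop : Coplanar ℝ (affineSpan ℝ ({a, b, c} : Set V) : Set V) :=
      coplanar_of_subset_affineSpan_triple subset_rfl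
    have := hcop.affineSpan_triple_eq hib (mem_affineSpan ℝ (by simp))
      (ey ▸ mem_affineSpan ℝ (by simp)) (ez ▸ mem_affineSpan ℝ (by simp))
    rw [this, AffineSubspace.affineSpan_coe]
  have e₁ := hplane hi h₁y h₁z
  have e₂ := hplane hi' h₂y h₂z
  refine ⟨cospherical_of_subset_sphere (o := o) (R := R)
    (by rintro p (rfl | rfl | rfl | rfl | rfl) <;> assumption), ?_⟩
  refine coplanar_of_subset_affineSpan_triple (a := b) (b := y) (c := z) ?_
  rintro p (rfl | rfl | rfl | rfl | rfl)
  · exact e₁ ▸ mem_affineSpan ℝ (by simp)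
  · exact mem_affineSpan ℝ (by simp)
  · exact e₁ ▸ mem_affineSpan ℝ (by simp)
  · exact e₂ ▸ mem_affineSpan ℝ (by simp)
  · exact e₂ ▸ mem_affineSpan ℝ (by simp)

/-- The edge vectors at a vertex of a nondegenerate tetrahedron are linearly independent. -/
theorem linearIndependent_of_not_coplanar [FiniteDimensional ℝ V] {x x₁ x₂ x₃ : V}
    (h : ¬ Coplanar ℝ {x, x₁, x₂, x₃}) : LinearIndependent ℝ ![x₁ - x, x₂ - x, x₃ - x] := by
  contrapose! h
  refine coplanar_of_vsub_mem x (Submodule.span ℝ (Set.range ![x₁ - x, x₂ - x, x₃ - x])) ?_ ?_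
  · have hle := finrank_range_le_card (R := ℝ) ![x₁ - x, x₂ - x, x₃ - x]
    rw [linearIndependent_iff_card_eq_finrank_span] at h
    simp only [Fintype.card_fin, Set.finrank] at h hle
    lia
  · rintro p (rfl | rfl | rfl | rfl)
    · simp
    · exact Submodule.subset_span ⟨0, rfl⟩
    · exact Submodule.subset_span ⟨1, rfl⟩
    · exact Submodule.subset_span ⟨2, rfl⟩

end Miquel

/-- **Cauchy problem for an elementary 3-cell; Miquel configuration.**
Let `Σ` be a sphere of positive radius in Euclidean 3-space and let
`x, x₁, x₂, x₃, x₁₂, x₁₃, x₂₃` be seven pairwise distinct points of `Σ` such that the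
quadruples `{x, x₁, x₁₂, x₂}`, `{x, x₂, x₂₃, x₃}`, `{x, x₁, x₁₃, x₃}` are concyclic.
If the triples `(x₁, x₁₂, x₁₃)`, `(x₂, x₁₂, x₂₃)`, `(x₃, x₁₃, x₂₃)` are each affinely
independent (determining circles `C₁`, `C₂`, `C₃`) and the three circles are pairwise
distinct (no five of the corresponding points are concyclic), then there is a point
`y ∈ Σ` lying on all three circles — the quadruples `{x₁, x₁₂, y, x₁₃}`,
`{x₂, x₁₂, y, x₂₃}`, `{x₃, x₁₃, y, x₂₃}` are concyclic — and any point lying on all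
three circles equals `y` or belongs to `{x₁₂, x₁₃, x₂₃}`: the missing eighth vertex of
an elementary 3-cell of a discrete curvature line net is determined by the other
seven. -/
theorem stmt19 (o : EuclideanSpace ℝ (Fin 3)) (R : ℝ) (hR : 0 < R)
    (x x₁ x₂ x₃ x₁₂ x₁₃ x₂₃ : EuclideanSpace ℝ (Fin 3))
    (hdist : Function.Injective ![x, x₁, x₂, x₃, x₁₂, x₁₃, x₂₃])
    (hxS : x ∈ sphere o R) (hx₁S : x₁ ∈ sphere o R) (hx₂S : x₂ ∈ sphere o R)
    (hx₃S : x₃ ∈ sphere o R) (hx₁₂S : x₁₂ ∈ sphere o R) (hx₁₃S : x₁₃ ∈ sphere o R)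
    (hx₂₃S : x₂₃ ∈ sphere o R)
    (hc₁₂ : Concyclic ({x, x₁, x₁₂, x₂} : Set (EuclideanSpace ℝ (Fin 3))))
    (hc₂₃ : Concyclic ({x, x₂, x₂₃, x₃} : Set (EuclideanSpace ℝ (Fin 3))))
    (hc₁₃ : Concyclic ({x, x₁, x₁₃, x₃} : Set (EuclideanSpace ℝ (Fin 3))))
    (haff₁ : AffineIndependent ℝ ![x₁, x₁₂, x₁₃])
    (haff₂ : AffineIndependent ℝ ![x₂, x₁₂, x₂₃])
    (haff₃ : AffineIndependent ℝ ![x₃, x₁₃, x₂₃])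
    (hC₁₂ : ¬ Concyclic ({x₁, x₁₂, x₁₃, x₂, x₂₃} : Set (EuclideanSpace ℝ (Fin 3))))
    (hC₁₃ : ¬ Concyclic ({x₁, x₁₂, x₁₃, x₃, x₂₃} : Set (EuclideanSpace ℝ (Fin 3))))
    (hC₂₃ : ¬ Concyclic ({x₂, x₁₂, x₂₃, x₃, x₁₃} : Set (EuclideanSpace ℝ (Fin 3)))) :
    ∃ y ∈ sphere o R,
      Concyclic ({x₁, x₁₂, y, x₁₃} : Set (EuclideanSpace ℝ (Fin 3))) ∧
      Concyclic ({x₂, x₁₂, y, x₂₃} : Set (EuclideanSpace ℝ (Fin 3))) ∧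
      Concyclic ({x₃, x₁₃, y, x₂₃} : Set (EuclideanSpace ℝ (Fin 3))) ∧
      ∀ z : EuclideanSpace ℝ (Fin 3),
        Concyclic ({x₁, x₁₂, z, x₁₃} : Set (EuclideanSpace ℝ (Fin 3))) →
        Concyclic ({x₂, x₁₂, z, x₂₃} : Set (EuclideanSpace ℝ (Fin 3))) →
        Concyclic ({x₃, x₁₃, z, x₂₃} : Set (EuclideanSpace ℝ (Fin 3))) →
        z = y ∨ z ∈ ({x₁₂, x₁₃, x₂₃} : Set (EuclideanSpace ℝ (Fin 3))) := by
  have hV : Module.finrank ℝ (EuclideanSpace ℝ (Fin 3)) = 3 := by simp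
  have ne : ∀ {i j : Fin 7}, i ≠ j → ![x, x₁, x₂, x₃, x₁₂, x₁₃, x₂₃] i ≠
    ![x, x₁, x₂, x₃, x₁₂, x₁₃, x₂₃] j := fun h ↦ hdist.ne h
  have n01 : x ≠ x₁ := ne (i := 0) (j := 1) (by decide)
  have n02 : x ≠ x₂ := ne (i := 0) (j := 2) (by decide)
  have n03 : x ≠ x₃ := ne (i := 0) (j := 3) (by decide)
  have n04 : x ≠ x₁₂ := ne (i := 0) (j := 4) (by decide)
  have n05 : x ≠ x₁₃ := ne (i := 0) (j := 5) (by decide)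
  have n06 : x ≠ x₂₃ := ne (i := 0) (j := 6) (by decide)
  have n12 : x₁ ≠ x₂ := ne (i := 1) (j := 2) (by decide)
  have n13 : x₁ ≠ x₃ := ne (i := 1) (j := 3) (by decide)
  have n23 : x₂ ≠ x₃ := ne (i := 2) (j := 3) (by decide)
  have n14 : x₁₂ ≠ x₁ := ne (i := 4) (j := 1) (by decide)
  have n24 : x₁₂ ≠ x₂ := ne (i := 4) (j := 2) (by decide)
  have n15 : x₁₃ ≠ x₁ := ne (i := 5) (j := 1) (by decide)
  have n35 : x₁₃ ≠ x₃ := ne (i := 5) (j := 3) (by decide)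
  have n26 : x₂₃ ≠ x₂ := ne (i := 6) (j := 2) (by decide)
  have n36 : x₂₃ ≠ x₃ := ne (i := 6) (j := 3) (by decide)
  have hindep : ∀ {a b : EuclideanSpace ℝ (Fin 3)}, a ∈ sphere o R → b ∈ sphere o R → x ≠ a →
      x ≠ b → a ≠ b → AffineIndependent ℝ ![x, a, b] := fun ha hb h₁ h₂ h₃ ↦
    (cospherical_of_subset_sphere (o := o) (R := R)
      (by rintro p (rfl | rfl | rfl) <;> assumption)).affineIndependent_of_ne h₁ h₂ h₃
  have hi₁₂ := hindep hx₁S hx₂S n01 n02 n12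
  have hi₁₃ := hindep hx₁S hx₃S n01 n03 n13
  have hi₂₃ := hindep hx₂S hx₃S n02 n03 n23
  have hplane : ∀ {a b d : EuclideanSpace ℝ (Fin 3)}, AffineIndependent ℝ ![x, a, b] →
      Concyclic {x, a, d, b} → d ∈ affineSpan ℝ {x, a, b} := fun hi hc ↦
    hc.Coplanar.affineSpan_triple_eq hi (by simp) (by simp) (by simp) ▸
      mem_affineSpan ℝ (by simp)
  have m₁₂ := hplane hi₁₂ hc₁₂
  have m₁₃ := hplane hi₁₃ hc₁₃
  have m₂₃ := hplane hi₂₃ hc₂₃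
  have hnc : ¬ Coplanar ℝ {x, x₁, x₂, x₃} := by
    intro hcop
    have e₁₂ := hcop.affineSpan_triple_eq hi₁₂ (by simp) (by simp) (by simp)
    have e₁₃ := hcop.affineSpan_triple_eq hi₁₃ (by simp) (by simp) (by simp)
    have e₂₃ := hcop.affineSpan_triple_eq hi₂₃ (by simp) (by simp) (by simp)
    refine hC₁₂ ⟨cospherical_of_subset_sphere (o := o) (R := R)
      (by rintro p (rfl | rfl | rfl | rfl | rfl) <;> assumption), ?_⟩
    refine coplanar_of_subset_affineSpan_triple (a := x) (b := x₁) (c := x₂) ?_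
    rintro p (rfl | rfl | rfl | rfl | rfl)
    · exact mem_affineSpan ℝ (by simp)
    · exact m₁₂
    · exact (e₁₃.trans e₁₂.symm) ▸ m₁₃
    · exact mem_affineSpan ℝ (by simp)
    · exact (e₂₃.trans e₁₂.symm) ▸ m₂₃
  let e := basisOfLinearIndependentOfCardEqFinrank (linearIndependent_of_not_coplanar hnc)
    (by simp)
  have he : ⇑e = ![x₁ - x, x₂ - x, x₃ - x] := coe_basisOfLinearIndependentOfCardEqFinrank _ _
  have e0 : e 0 = x₁ - x := by simp [he]
  have e1 : e 1 = x₂ - x := by simp [he]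
  have e2 : e 2 = x₃ - x := by simp [he]
  obtain ⟨p₁₂, q₁₂, hd₁₂⟩ := exists_sub_eq_of_mem_affineSpan_triple m₁₂
  obtain ⟨p₁₃, q₁₃, hd₁₃⟩ := exists_sub_eq_of_mem_affineSpan_triple m₁₃
  obtain ⟨p₂₃, q₂₃, hd₂₃⟩ := exists_sub_eq_of_mem_affineSpan_triple m₂₃
  have hcoeff : ∀ {a b d : EuclideanSpace ℝ (Fin 3)} {p q : ℝ}, a ∈ sphere o R →
      b ∈ sphere o R → d ∈ sphere o R → x ≠ a → x ≠ b → x ≠ d → d ≠ a → d ≠ b →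
      d - x = p • (a - x) + q • (b - x) → p ≠ 0 ∧ q ≠ 0 := by
    intro a b d p q ha hb hd hxa hxb hxd hda hdb h
    rw [mem_sphere_iff_inner_sub hxS] at ha hb hd
    have hda' : d - x ≠ a - x := fun h ↦ hda (sub_left_injective h)
    have hdb' : d - x ≠ b - x := fun h ↦ hdb (sub_left_injective h)
    exact ⟨coeff_ne_zero_of_mem_sphere hb hd (h.trans (add_comm _ _)) (sub_ne_zero.2 hxb.symm)
      (sub_ne_zero.2 hxd.symm) hdb', coeff_ne_zero_of_mem_sphere ha hd h
      (sub_ne_zero.2 hxa.symm) (sub_ne_zero.2 hxd.symm) hda'⟩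
  obtain ⟨hp₁₂, hq₁₂⟩ := hcoeff hx₁S hx₂S hx₁₂S n01 n02 n04 n14 n24 hd₁₂
  obtain ⟨hp₁₃, hq₁₃⟩ := hcoeff hx₁S hx₃S hx₁₃S n01 n03 n05 n15 n35 hd₁₃
  obtain ⟨hp₂₃, hq₂₃⟩ := hcoeff hx₂S hx₃S hx₂₃S n02 n03 n06 n26 n36 hd₂₃
  rw [← e0, ← e1] at hd₁₂
  rw [← e0, ← e2] at hd₁₃
  rw [← e1, ← e2] at hd₂₃
  have hsphere {p} := mem_sphere_iff_inner_sub (p := p) hxS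
  obtain ⟨w, f, r, hw, hf, h₁, h₂, h₃, h₄, h₅, h₆⟩ := exists_miquel_point e
    (by
      refine Fin.forall_fin_succ.2 ⟨?_, Fin.forall_fin_two.2 ⟨?_, ?_⟩⟩
      · exact e0.symm ▸ hsphere.1 hx₁S
      · exact e1.symm ▸ hsphere.1 hx₂S
      · exact e2.symm ▸ hsphere.1 hx₃S)
    (hsphere.1 hx₁₂S) (hsphere.1 hx₁₃S) (hsphere.1 hx₂₃S) hd₁₂ hd₁₃ hd₂₃ hp₁₂ hq₁₂ hp₁₃ hq₁₃
    hp₂₃ hq₂₃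
  have hf0 : ∀ i, f i ≠ 0 := fun i h ↦ (hf i).1 (by simpa [h] using (hf i).2.1.symm)
  have hwS : w + x ∈ sphere o R := hsphere.2 (by simpa using hw)
  have hy₁ : Concyclic {x₁, x₁₂, w + x, x₁₃} := by
    refine concyclic_of_linear_form_eq hV (o := o) (R := R) ?_ (hf0 0) (x := x) (r := r 0) ?_
    · rintro p (rfl | rfl | rfl | rfl) <;> assumption
    · rintro p (rfl | rfl | rfl | rfl)
      exacts [e0 ▸ (hf 0).2.1, h₁, by simpa using (hf 0).2.2, h₂]
  have hy₂ : Concyclic {x₂, x₁₂, w + x, x₂₃} := by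
    refine concyclic_of_linear_form_eq hV (o := o) (R := R) ?_ (hf0 1) (x := x) (r := r 1) ?_
    · rintro p (rfl | rfl | rfl | rfl) <;> assumption
    · rintro p (rfl | rfl | rfl | rfl)
      exacts [e1 ▸ (hf 1).2.1, h₃, by simpa using (hf 1).2.2, h₄]
  have hy₃ : Concyclic {x₃, x₁₃, w + x, x₂₃} := by
    refine concyclic_of_linear_form_eq hV (o := o) (R := R) ?_ (hf0 2) (x := x) (r := r 2) ?_
    · rintro p (rfl | rfl | rfl | rfl) <;> assumption
    · rintro p (rfl | rfl | rfl | rfl)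
      exacts [e2 ▸ (hf 2).2.1, h₅, by simpa using (hf 2).2.2, h₆]
  by_cases hex : ∃ y, y ≠ x₁₂ ∧ Concyclic {x₁, x₁₂, y, x₁₃} ∧ Concyclic {x₂, x₁₂, y, x₂₃} ∧
      Concyclic {x₃, x₁₃, y, x₂₃}
  · obtain ⟨y, hne, hc₁, hc₂, hc₃⟩ := hex
    have hyS : y ∈ sphere o R := hc₁.subset_sphere haff₁ (by simp) (by simp) (by simp) hx₁S
      hx₁₂S hx₁₃S (by simp)
    refine ⟨y, hyS, hc₁, hc₂, hc₃, fun z hz₁ hz₂ _ ↦ ?_⟩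
    by_contra! hz
    obtain ⟨hzy, hz⟩ := hz
    exact hC₁₂ (concyclic_of_three_common_points hx₁S hx₁₂S hx₁₃S hx₂S hx₂₃S hyS haff₁ haff₂
      hc₁ hz₁ hc₂ hz₂ hne.symm (fun h ↦ hz (by simp [h])) hzy.symm)
  · refine ⟨w + x, hwS, hy₁, hy₂, hy₃, fun z hz₁ hz₂ hz₃ ↦ Or.inr ?_⟩
    by_contra hz
    exact hex ⟨z, fun h ↦ hz (by simp [h]), hz₁, hz₂, hz₃⟩
end
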